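/- arXiv:2007.07442 — 3 statements merged into one kernel-verified Lean document; each statement's English description precedes it below -/
import Mathlib

section
/- Let k be a natural number, let a < b be real numbers, let h : ℝ → ℝ be k times continuously differentiable with h^(l)(a) = h^(l)(b) for all 0 ≤ l ≤ k, let r₀, r₁ be real numbers, and let σ : ℝ → ℝ be k times continuously differentiable. Define v(x) = σ(h(x) + (r₀ + r₁ x)(x − a)^{k+1}(x − b)^{k+1}). Then v^(l)(a) = v^(l)(b) for all 0 ≤ l ≤ k. -/
/-- The derivatives of order at most `k` of a composition agree at two points where those of the
inner function do. -/
theorem iteratedDeriv_comp_eq_of_iteratedDeriv_eq {k : ℕ} {σ f : ℝ → ℝ} {a b : ℝ}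
    (hσ : ContDiff ℝ k σ) (hf : ContDiff ℝ k f)
    (hfab : ∀ l : ℕ, l ≤ k → iteratedDeriv l f a = iteratedDeriv l f b)
    {l : ℕ} (hl : l ≤ k) :
    iteratedDeriv l (σ ∘ f) a = iteratedDeriv l (σ ∘ f) b := by
  have h0 : f a = f b := by simpa using hfab 0 (Nat.zero_le k)
  have hlk : (l : WithTop ℕ∞) ≤ k := by exact_mod_cast hl
  rw [iteratedDeriv_comp_eq_sum_orderedFinpartition hσ.contDiffAt hf.contDiffAt hlk,
    iteratedDeriv_comp_eq_sum_orderedFinpartition hσ.contDiffAt hf.contDiffAt hlk, h0]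
  refine Finset.sum_congr rfl fun c _ => ?_
  congr 1
  exact Finset.prod_congr rfl fun j _ => hfab _ ((c.partSize_le j).trans hl)

/-- A product with a factor vanishing to order `k + 1` at `c` has vanishing derivatives at `c` up
to order `k`. -/
theorem iteratedDeriv_sub_pow_succ_mul_eq_zero {k l : ℕ} {c : ℝ} {q : ℝ → ℝ}
    (hq : AnalyticAt ℝ q c) (hl : l ≤ k) :
    iteratedDeriv l (fun x => (x - c) ^ (k + 1) * q x) c = 0 := by
  have hf : AnalyticAt ℝ (fun x => (x - c) ^ (k + 1) * q x) c := by fun_prop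
  refine (natCast_le_analyticOrderAt_iff_iteratedDeriv_eq_zero hf (n := k + 1)).1 ?_ l (by omega)
  exact (natCast_le_analyticOrderAt hf).2 ⟨q, hq, by simp⟩

theorem sigma_comp_hermite_bump_ck_periodic (k : ℕ) (a b : ℝ) (hab : a < b)
    (h : ℝ → ℝ) (hh : ContDiff ℝ k h)
    (hhab : ∀ l : ℕ, l ≤ k → iteratedDeriv l h a = iteratedDeriv l h b)
    (r₀ r₁ : ℝ) (σ : ℝ → ℝ) (hσ : ContDiff ℝ k σ)
    (v : ℝ → ℝ)
    (hv : ∀ x : ℝ,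
      v x = σ (h x + (r₀ + r₁ * x) * (x - a) ^ (k + 1) * (x - b) ^ (k + 1))) :
    ∀ l : ℕ, l ≤ k → iteratedDeriv l v a = iteratedDeriv l v b := by
  intro l hl
  set p : ℝ → ℝ := fun x => (r₀ + r₁ * x) * (x - a) ^ (k + 1) * (x - b) ^ (k + 1) with hp
  have hpk : ContDiff ℝ k p := by fun_prop
  have hpa : p = fun x => (x - a) ^ (k + 1) * ((r₀ + r₁ * x) * (x - b) ^ (k + 1)) := by
    ext x; simp only [hp]; ring
  have hpb : p = fun x => (x - b) ^ (k + 1) * ((r₀ + r₁ * x) * (x - a) ^ (k + 1)) := by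
    ext x; simp only [hp]; ring
  have hvp : v = σ ∘ (h + p) := funext hv
  rw [hvp]
  refine iteratedDeriv_comp_eq_of_iteratedDeriv_eq hσ (hh.add hpk) (fun m hm => ?_) hl
  have hmk : (m : WithTop ℕ∞) ≤ k := by exact_mod_cast hm
  have hpa0 : iteratedDeriv m p a = 0 := by
    rw [hpa]; exact iteratedDeriv_sub_pow_succ_mul_eq_zero (by fun_prop) hm
  have hpb0 : iteratedDeriv m p b = 0 := by
    rw [hpb]; exact iteratedDeriv_sub_pow_succ_mul_eq_zero (by fun_prop) hm
  rw [iteratedDeriv_fun_add (hh.of_le hmk).contDiffAt (hpk.of_le hmk).contDiffAt,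
    iteratedDeriv_fun_add (hh.of_le hmk).contDiffAt (hpk.of_le hmk).contDiffAt, hpa0, hpb0, hhab m hm]
end

section
/- Let a < b be real numbers, let ξ = 1/(b − a), and let s₀, s₁, s₂, r₀, r₁ be real numbers. Define p(x) = ξ³(x − a)³[s₀ + (−3s₀ξ + s₁)(x − b) + (6s₀ξ² − 3s₁ξ + s₂/2)(x − b)²] + ξ³(b − x)³[s₀ + (3s₀ξ + s₁)(x − a) + (6s₀ξ² + 3s₁ξ + s₂/2)(x − a)²] + (r₀ + r₁ x)(x − a)³(x − b)³. Then p(a) = p(b) = s₀, p'(a) = p'(b) = s₁, and p''(a) = p''(b) = s₂; in particular p satisfies the C^2 periodic conditions on [a, b]. -/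
theorem c2_periodic_explicit (a b : ℝ) (hab : a < b) (ξ : ℝ) (hξ : ξ = 1 / (b - a))
    (s₀ s₁ s₂ r₀ r₁ : ℝ) (p : ℝ → ℝ)
    (hp : ∀ x : ℝ, p x =
      ξ ^ 3 * (x - a) ^ 3 * (s₀ + (-3 * s₀ * ξ + s₁) * (x - b)
        + (6 * s₀ * ξ ^ 2 - 3 * s₁ * ξ + s₂ / 2) * (x - b) ^ 2)
      + ξ ^ 3 * (b - x) ^ 3 * (s₀ + (3 * s₀ * ξ + s₁) * (x - a)
        + (6 * s₀ * ξ ^ 2 + 3 * s₁ * ξ + s₂ / 2) * (x - a) ^ 2)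
      + (r₀ + r₁ * x) * (x - a) ^ 3 * (x - b) ^ 3) :
    (p a = s₀ ∧ p b = s₀) ∧ (deriv p a = s₁ ∧ deriv p b = s₁) ∧
      (iteratedDeriv 2 p a = s₂ ∧ iteratedDeriv 2 p b = s₂) := by
  open Polynomial in
  let P : ℝ[X] :=
    C (ξ ^ 3) * (X - C a) ^ 3 * (C s₀ + C (-3 * s₀ * ξ + s₁) * (X - C b)
        + C (6 * s₀ * ξ ^ 2 - 3 * s₁ * ξ + s₂ / 2) * (X - C b) ^ 2)
      + C (ξ ^ 3) * (C b - X) ^ 3 * (C s₀ + C (3 * s₀ * ξ + s₁) * (X - C a)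
        + C (6 * s₀ * ξ ^ 2 + 3 * s₁ * ξ + s₂ / 2) * (X - C a) ^ 2)
      + (C r₀ + C r₁ * X) * (X - C a) ^ 3 * (X - C b) ^ 3
  have hpP : p = fun x => P.eval x := by
    funext x
    simp only [hp, P, Polynomial.eval_add, Polynomial.eval_sub, Polynomial.eval_mul,
      Polynomial.eval_pow, Polynomial.eval_C, Polynomial.eval_X]
  have hderiv : deriv p = fun x => P.derivative.eval x := by
    funext x
    rw [hpP, Polynomial.deriv]
  have hderiv₂ : iteratedDeriv 2 p = fun x => P.derivative.derivative.eval x := by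
    funext x
    rw [iteratedDeriv_succ, iteratedDeriv_one, hderiv, Polynomial.deriv]
  have hba : b - a ≠ 0 := sub_ne_zero.mpr hab.ne'
  rw [hderiv, hderiv₂, hpP]
  refine ⟨⟨?_, ?_⟩, ⟨?_, ?_⟩, ?_, ?_⟩ <;>
  · simp only [P, Polynomial.derivative_add, Polynomial.derivative_sub, Polynomial.derivative_mul,
      Polynomial.derivative_pow, Polynomial.derivative_C, Polynomial.derivative_X,
      Polynomial.derivative_one, Polynomial.derivative_zero,
      Polynomial.eval_add, Polynomial.eval_sub, Polynomial.eval_mul, Polynomial.eval_pow,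
      Polynomial.eval_C, Polynomial.eval_X, Polynomial.eval_one, Polynomial.eval_zero, sub_self, hξ]
    field_simp
    ring
end

section
/- Let k, m be natural numbers with m ≥ 1, let a₁ < b₁ and a₂ < b₂ be real numbers, and let v₁, …, v_m, w₁, …, w_m : ℝ → ℝ be k times continuously differentiable functions with v_i^(l)(a₁) = v_i^(l)(b₁) and w_i^(l)(a₂) = w_i^(l)(b₂) for all 0 ≤ l ≤ k and 1 ≤ i ≤ m. Let F : ℝ^{2m} → ℝ be k times continuously differentiable and define u(x₁, x₂) = F(v₁(x₁), …, v_m(x₁), w₁(x₂), …, w_m(x₂)). Then for every 0 ≤ α ≤ k and all x₂ ∈ [a₂, b₂], ∂^α u/∂x₁^α (a₁, x₂) = ∂^α u/∂x₁^α (b₁, x₂), and for all x₁ ∈ [a₁, b₁], ∂^α u/∂x₂^α (x₁, a₂) = ∂^α u/∂x₂^α (x₁, b₂). -/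
theorem iteratedDeriv_apply_of_contDiffAt {𝕜 ι E : Type*} [NontriviallyNormedField 𝕜] [Fintype ι]
    [NormedAddCommGroup E] [NormedSpace 𝕜 E] {f : 𝕜 → ι → E} {x : 𝕜} {n : ℕ}
    (hf : ContDiffAt 𝕜 n f x) (i : ι) :
    iteratedDeriv n f x i = iteratedDeriv n (fun t => f t i) x := by
  have h := (ContinuousLinearMap.proj (R := 𝕜) (φ := fun _ : ι => E) i).iteratedFDeriv_comp_left
    hf le_rfl
  exact (congrArg (fun M => M fun _ => (1 : 𝕜)) h).symm

/-- By Faà di Bruno's formula, the `n`-th derivative of `g ∘ f` at a point depends only on the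
derivatives of `f` of order at most `n` at that point. -/
theorem iteratedDeriv_comp_eq_of_forall_le {𝕜 E F : Type*} [NontriviallyNormedField 𝕜]
    [NormedAddCommGroup E] [NormedSpace 𝕜 E] [NormedAddCommGroup F] [NormedSpace 𝕜 F]
    {g : E → F} {f : 𝕜 → E} {a b : 𝕜} {n : ℕ}
    (hg : ContDiffAt 𝕜 n g (f a)) (hfa : ContDiffAt 𝕜 n f a) (hfb : ContDiffAt 𝕜 n f b)
    (h : ∀ l ≤ n, iteratedDeriv l f a = iteratedDeriv l f b) :
    iteratedDeriv n (g ∘ f) a = iteratedDeriv n (g ∘ f) b := by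
  have h0 : f a = f b := by simpa using h 0 n.zero_le
  rw [iteratedDeriv_vcomp_eq_sum_orderedFinpartition hg hfa le_rfl,
    iteratedDeriv_vcomp_eq_sum_orderedFinpartition (h0 ▸ hg) hfb le_rfl, h0]
  refine Finset.sum_congr rfl fun c _ => congrArg _ (funext fun j => h _ (c.partSize_le j))

theorem iteratedDeriv_comp_pi_eq_of_forall_le {𝕜 ι E F : Type*} [NontriviallyNormedField 𝕜]
    [Fintype ι] [NormedAddCommGroup E] [NormedSpace 𝕜 E] [NormedAddCommGroup F] [NormedSpace 𝕜 F]
    {g : (ι → E) → F} {f : 𝕜 → ι → E} {a b : 𝕜} {n : ℕ}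
    (hg : ContDiff 𝕜 n g) (hf : ∀ i, ContDiff 𝕜 n fun t => f t i)
    (h : ∀ i, ∀ l ≤ n, iteratedDeriv l (fun t => f t i) a = iteratedDeriv l (fun t => f t i) b) :
    iteratedDeriv n (fun t => g (f t)) a = iteratedDeriv n (fun t => g (f t)) b := by
  have hf' : ContDiff 𝕜 n f := contDiff_pi.2 hf
  refine iteratedDeriv_comp_eq_of_forall_le hg.contDiffAt hf'.contDiffAt hf'.contDiffAt
    fun l hl => funext fun i => ?_
  have hfl : ContDiff 𝕜 l f := hf'.of_le (mod_cast hl)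
  rw [iteratedDeriv_apply_of_contDiffAt hfl.contDiffAt,
    iteratedDeriv_apply_of_contDiffAt hfl.contDiffAt, h i l hl]

theorem ck_periodic_layer_2d_boundary_derivs (k m : ℕ) (hm : 1 ≤ m)
    (a₁ b₁ a₂ b₂ : ℝ) (hab₁ : a₁ < b₁) (hab₂ : a₂ < b₂)
    (v w : Fin m → ℝ → ℝ)
    (hv : ∀ i, ContDiff ℝ k (v i)) (hw : ∀ i, ContDiff ℝ k (w i))
    (hvp : ∀ i, ∀ l : ℕ, l ≤ k →
      iteratedDeriv l (v i) a₁ = iteratedDeriv l (v i) b₁)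
    (hwp : ∀ i, ∀ l : ℕ, l ≤ k →
      iteratedDeriv l (w i) a₂ = iteratedDeriv l (w i) b₂)
    (F : (Fin m ⊕ Fin m → ℝ) → ℝ) (hF : ContDiff ℝ k F)
    (u : ℝ → ℝ → ℝ)
    (hu : ∀ x₁ x₂ : ℝ, u x₁ x₂ = F (Sum.elim (fun i => v i x₁) (fun i => w i x₂))) :
    ∀ α : ℕ, α ≤ k →
      (∀ x₂ ∈ Set.Icc a₂ b₂,
        iteratedDeriv α (fun x₁ => u x₁ x₂) a₁ = iteratedDeriv α (fun x₁ => u x₁ x₂) b₁) ∧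
      (∀ x₁ ∈ Set.Icc a₁ b₁,
        iteratedDeriv α (fun x₂ => u x₁ x₂) a₂ = iteratedDeriv α (fun x₂ => u x₁ x₂) b₂) := by
  intro α hα
  have hαk : (α : WithTop ℕ∞) ≤ k := mod_cast hα
  simp only [hu]
  refine ⟨fun x₂ _ => ?_, fun x₁ _ => ?_⟩
  · refine iteratedDeriv_comp_pi_eq_of_forall_le (hF.of_le hαk) ?_ ?_
    · rintro (i | i)
      · exact (hv i).of_le hαk
      · exact contDiff_const
    · rintro (i | i) l hl
      · exact hvp i l (hl.trans hα)
      · simp [iteratedDeriv_const]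
  · refine iteratedDeriv_comp_pi_eq_of_forall_le (hF.of_le hαk) ?_ ?_
    · rintro (i | i)
      · exact contDiff_const
      · exact (hw i).of_le hαk
    · rintro (i | i) l hl
      · simp [iteratedDeriv_const]
      · exact hwp i l (hl.trans hα)
end
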